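/- arXiv:math/9807062 — 2 statements merged into one kernel-verified Lean document; each statement's English description precedes it below -/
import Mathlib

section
/- The following three σ-algebras on K̄ coincide: the Borel σ-algebra B(K̄) of the seminorm topology of K̄; the Borel σ-algebra B(K̄,K) of the weak topology σ(K̄,K); and the smallest σ-algebra A(K̄) with respect to which all continuous k-linear functionals K̄ → k are measurable. -/
open MeasureTheory Module
open scoped Classical

noncomputable section

/-- The topology defined by a translation-invariant "norm" function via open balls. -/
def normTopology {X : Type} [Sub X] (f : X → ℝ) : TopologicalSpace X :=
  TopologicalSpace.generateFrom
    {U | ∃ x : X, ∃ ε : ℝ, 0 < ε ∧ U = {y : X | f (y - x) < ε}}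

variable (p : ℕ) [Fact (Nat.Prime p)]
variable (k : Type) [Field k] [Algebra ℚ_[p] k] [FiniteDimensional ℚ_[p] k]

/-- The normalized absolute value on the local field k. -/
def absk (x : k) : ℝ := ‖(Algebra.norm ℚ_[p] x : ℚ_[p])‖

/-- The topology of k as a local field. -/
def kTop : TopologicalSpace k := normTopology (absk p k)

variable (K : Type) [Field K] [Algebra k K] [CharZero K]
variable (Kn : ℕ → IntermediateField k K)

/-- The relative trace map between two intermediate fields. -/
def relTrace (E F : IntermediateField k K) (h : E ≤ F) (x : F) : E :=
  (@Algebra.trace E F _ _ (IntermediateField.inclusion h).toRingHom.toAlgebra) x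

variable (T : ℕ → K →ₗ[k] K)

/-- The projective limit K̄ of the fields Kₙ along the normalized trace maps. -/
def ProjLim : Type :=
  {x : ℕ → K // (∀ n, x n ∈ Kn n) ∧ ∀ ⦃n ν : ℕ⦄, n ≤ ν → T n (x ν) = x n}

/-- Pointwise addition on K̄. -/
def pladd (x y : ProjLim k K Kn T) : ProjLim k K Kn T :=
  ⟨fun n => x.1 n + y.1 n, by
    refine ⟨fun n => add_mem (x.2.1 n) (y.2.1 n), ?_⟩
    intro n ν h
    simp [map_add, x.2.2 h, y.2.2 h]⟩

/-- Pointwise scalar multiplication on K̄. -/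
def plsmul (c : k) (x : ProjLim k K Kn T) : ProjLim k K Kn T :=
  ⟨fun n => c • x.1 n, by
    refine ⟨fun n => (Kn n).toSubalgebra.smul_mem (x.2.1 n) c, ?_⟩
    intro n ν h
    simp [_root_.map_smul, x.2.2 h]⟩

/-- The topology on K̄ given by the seminorms x ↦ ‖xₙ‖. -/
def projTop (Knorm : K → ℝ) : TopologicalSpace (ProjLim k K Kn T) :=
  TopologicalSpace.generateFrom
    {U | ∃ x : ProjLim k K Kn T, ∃ n : ℕ, ∃ ε : ℝ, 0 < ε ∧
          U = {y : ProjLim k K Kn T | Knorm (y.1 n - x.1 n) < ε}}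

/-- The Borel σ-algebra of the seminorm topology on K̄. -/
def projMeas (Knorm : K → ℝ) : MeasurableSpace (ProjLim k K Kn T) :=
  @borel _ (projTop k K Kn T Knorm)

/-- The topology on Kₙ induced from the absolute value ‖·‖. -/
def KnTop (Knorm : K → ℝ) (n : ℕ) : TopologicalSpace (Kn n) :=
  TopologicalSpace.induced Subtype.val (normTopology Knorm)

/-- The Borel σ-algebra of Kₙ. -/
def KnMeas (Knorm : K → ℝ) (n : ℕ) : MeasurableSpace (Kn n) :=
  @borel _ (KnTop k K Kn Knorm n)

/-- The canonical embedding of K into K̄. -/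
def emb (hTmem : ∀ n x, T n x ∈ Kn n)
    (hTproj : ∀ ⦃n ν : ℕ⦄, n ≤ ν → ∀ x : K, T n (T ν x) = T n x) (x : K) :
    ProjLim k K Kn T :=
  ⟨fun n => T n x, fun n => hTmem n x, fun n ν h => hTproj h x⟩

/-- The weak topology σ(K̄, K) on K̄. -/
def weakTop (pairing : K → ProjLim k K Kn T → k) : TopologicalSpace (ProjLim k K Kn T) :=
  ⨅ a : K, TopologicalSpace.induced (pairing a) (kTop p k)

/-- Non-archimedean seminorms on K over k. -/
def IsNASeminorm (f : K → ℝ) : Prop :=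
  (∀ x, 0 ≤ f x) ∧ (∀ x y, f (x + y) ≤ max (f x) (f y)) ∧
    ∀ (c : k) (x : K), f (c • x) = absk p k c * f x

/-- The locally convex topology determined by a family of seminorms. -/
def seminormFamilyTop (F : Set (K → ℝ)) : TopologicalSpace K :=
  TopologicalSpace.generateFrom
    {U | ∃ f ∈ F, ∃ x : K, ∃ ε : ℝ, 0 < ε ∧ U = {y : K | f (y - x) < ε}}

/-- The inductive limit topology on K: the finest locally convex topology over k
making all the inclusions Kₙ → K continuous. -/
def indTop (Knorm : K → ℝ) : TopologicalSpace K :=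
  sInf {t : TopologicalSpace K |
    (∃ F : Set (K → ℝ), (∀ f ∈ F, IsNASeminorm p k K f) ∧ t = seminormFamilyTop K F) ∧
    ∀ n : ℕ, @Continuous _ _ (KnTop k K Kn Knorm n) t Subtype.val}

/-- Locally constant functions with bounded (hence compact) support on Kₙ. -/
def IsTestFun (Knorm : K → ℝ) (n : ℕ) (φ : Kn n → ℂ) : Prop :=
  @IsLocallyConstant _ _ (KnTop k K Kn Knorm n) φ ∧
    ∃ R : ℝ, ∀ ξ : Kn n, R < Knorm ↑ξ → φ ξ = 0


/-- The fractional differentiation operator Dᵅ applied to the cylindrical function φ ∘ Tₙ. -/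
def Dop (Knorm : K → ℝ) (χ : k → ℂ) (pairing : K → ProjLim k K Kn T → k)
    (vol : ∀ n : ℕ, @MeasureTheory.Measure (Kn n) (KnMeas k K Kn Knorm n))
    (μ : @MeasureTheory.Measure (ProjLim k K Kn T) (projMeas k K Kn T Knorm))
    (α : ℝ) (n : ℕ) (φ : Kn n → ℂ) (x : ProjLim k K Kn T) : ℂ :=
  ∫ ξ : Kn n,
    χ ((finrank k (Kn n) : k)⁻¹ *
        Algebra.trace k (Kn n) (-(⟨x.1 n, x.2.1 n⟩ * ξ))) *
      (if 1 < Knorm ↑ξ then ((Knorm ↑ξ ^ α : ℝ) : ℂ) else 0) *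
      (∫ y, χ (pairing (↑ξ) y) * φ ⟨y.1 n, y.2.1 n⟩ ∂μ) ∂(vol n)
end

theorem induced_eq_generateFrom_norm_pow {Y E : Type*} [SeminormedAddCommGroup E] (g : Y → E)
    {d : ℕ} (hd : d ≠ 0) :
    TopologicalSpace.induced g inferInstance = TopologicalSpace.generateFrom
      {U | ∃ x : Y, ∃ ε : ℝ, 0 < ε ∧ U = {y : Y | ‖g y - g x‖ ^ d < ε}} := by
  apply le_antisymm
  · refine le_generateFrom ?_
    rintro U ⟨x, ε, -, rfl⟩
    exact ⟨{v : E | ‖v - g x‖ ^ d < ε}, isOpen_lt (by fun_prop) continuous_const, rfl⟩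
  · rintro _ ⟨V, hV, rfl⟩
    let : TopologicalSpace Y := TopologicalSpace.generateFrom
      {U | ∃ x : Y, ∃ ε : ℝ, 0 < ε ∧ U = {y : Y | ‖g y - g x‖ ^ d < ε}}
    refine isOpen_iff_mem_nhds.2 fun x hx => ?_
    obtain ⟨ε, hε, hball⟩ := Metric.isOpen_iff.1 hV (g x) hx
    have hopen : IsOpen {y : Y | ‖g y - g x‖ ^ d < ε ^ d} :=
      TopologicalSpace.isOpen_generateFrom_of_mem ⟨x, ε ^ d, by positivity, rfl⟩
    refine Filter.mem_of_superset (hopen.mem_nhds ?_) fun y hy => hball ?_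
    · simp [hd, hε]
    · rw [mem_ball_iff_norm]
      exact lt_of_pow_lt_pow_left₀ d hε.le hy

section Cylinder

variable {𝕜 : Type*} [NontriviallyNormedField 𝕜] [CompleteSpace 𝕜]
  {F : Type*} [NormedAddCommGroup F] [NormedSpace 𝕜 F]

theorem induced_eq_iInf_of_separating {Y W ι : Type*} [Finite ι] [NormedAddCommGroup W]
    [NormedSpace 𝕜 W] [FiniteDimensional 𝕜 W] (f : Y → W) (L : ι → W →ₗ[𝕜] F)
    (hL : ∀ w, (∀ i, L i w = 0) → w = 0) :
    TopologicalSpace.induced f inferInstance =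
      ⨅ i, TopologicalSpace.induced (fun y => L i (f y)) inferInstance := by
  have := Fintype.ofFinite ι
  have hker : LinearMap.ker (LinearMap.pi L) = ⊥ :=
    LinearMap.ker_eq_bot'.2 fun w hw => hL w fun i => congrFun hw i
  have hind : Topology.IsInducing (LinearMap.pi L) := by
    let W' := LinearMap.range (LinearMap.pi L)
    let e : W ≃L[𝕜] W' :=
      (LinearEquiv.ofInjective _ (LinearMap.ker_eq_bot.1 hker)).toContinuousLinearEquiv
    exact Topology.IsInducing.subtypeVal.comp e.toHomeomorph.isInducing
  rw [hind.eq_induced, induced_compose, Pi.topologicalSpace, induced_iInf]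
  refine iInf_congr fun i => ?_
  rw [induced_compose]
  rfl

variable {Y A : Type*} {W : ℕ → Type*} [∀ n, NormedAddCommGroup (W n)]
  [∀ n, NormedSpace 𝕜 (W n)] [∀ n, FiniteDimensional 𝕜 (W n)] (f : ∀ n, Y → W n)
  (pair : A → Y → F) {m : ℕ → ℕ} (b : ∀ n, Fin (m n) → A) (L : ∀ n, A → W n →ₗ[𝕜] F)

theorem iInf_induced_eq_iInf_sigma
    (hb : ∀ n i y, pair (b n i) y = L n (b n i) (f n y))
    (hsep : ∀ n w, (∀ i, L n (b n i) w = 0) → w = 0) :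
    ⨅ n, TopologicalSpace.induced (f n) inferInstance =
      ⨅ j : Σ n, Fin (m n), TopologicalSpace.induced (pair (b j.1 j.2)) inferInstance := by
  rw [iInf_sigma]
  refine iInf_congr fun n => ?_
  rw [induced_eq_iInf_of_separating (f n) (fun i => L n (b n i)) (hsep n)]
  simp_rw [← hb n]

theorem iInf_induced_eq_iInf_pairing
    (hb : ∀ n i y, pair (b n i) y = L n (b n i) (f n y))
    (hsep : ∀ n w, (∀ i, L n (b n i) w = 0) → w = 0)
    (hfac : ∀ a, ∃ n, ∀ y, pair a y = L n a (f n y)) :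
    ⨅ n, TopologicalSpace.induced (f n) inferInstance =
      ⨅ a, TopologicalSpace.induced (pair a) inferInstance := by
  apply le_antisymm
  · refine le_iInf fun a => ?_
    obtain ⟨n, hn⟩ := hfac a
    refine (iInf_le _ n).trans ?_
    rw [funext hn, ← continuous_iff_le_induced]
    let := TopologicalSpace.induced (f n) inferInstance
    exact (L n a).continuous_of_finiteDimensional.comp continuous_induced_dom
  · rw [iInf_induced_eq_iInf_sigma f pair b L hb hsep]
    exact le_iInf fun j => iInf_le _ _

theorem borel_iInf_induced_le_iSup_comap [SecondCountableTopology F]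
    (hb : ∀ n i y, pair (b n i) y = L n (b n i) (f n y))
    (hsep : ∀ n w, (∀ i, L n (b n i) w = 0) → w = 0) :
    @borel Y (⨅ n, TopologicalSpace.induced (f n) inferInstance) ≤
      ⨆ a, MeasurableSpace.comap (pair a) (borel F) := by
  rw [iInf_induced_eq_iInf_sigma f pair b L hb hsep]
  have h : ⨅ j : Σ n, Fin (m n), TopologicalSpace.induced (pair (b j.1 j.2)) inferInstance =
      TopologicalSpace.induced (fun y (j : Σ n, Fin (m n)) => pair (b j.1 j.2) y)
        inferInstance := by
    rw [Pi.topologicalSpace, induced_iInf]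
    refine iInf_congr fun j => ?_
    rw [induced_compose]
    rfl
  borelize F
  rw [h, borel_comap, ← BorelSpace.measurable_eq, MeasurableSpace.pi, MeasurableSpace.comap_iSup]
  refine iSup_le fun j => ?_
  rw [MeasurableSpace.comap_comp]
  exact le_iSup (fun a => MeasurableSpace.comap (pair a) (borel F)) (b j.1 j.2)

end Cylinder

theorem norm_algebraNorm_eq_spectralNorm_pow (𝕜 : Type*) [NontriviallyNormedField 𝕜]
    [CompleteSpace 𝕜] [IsUltrametricDist 𝕜] [CharZero 𝕜] (L : Type*) [Field L] [Algebra 𝕜 L]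
    [FiniteDimensional 𝕜 L] (x : L) :
    ‖Algebra.norm 𝕜 x‖ = spectralNorm 𝕜 L x ^ Module.finrank 𝕜 L := by
  have hσ (σ : L →ₐ[𝕜] AlgebraicClosure 𝕜) :
      spectralNorm 𝕜 (AlgebraicClosure 𝕜) (σ x) = spectralNorm 𝕜 L x := by
    rw [spectralNorm, spectralNorm, minpoly.algHom_eq σ σ.injective]
  rw [← spectralNorm_extends (L := AlgebraicClosure 𝕜),
    Algebra.norm_eq_prod_embeddings 𝕜 (AlgebraicClosure 𝕜) x, ← spectralMulAlgNorm_def, map_prod]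
  simp_rw [spectralMulAlgNorm_def, hσ]
  rw [Finset.prod_const, Finset.card_univ, AlgHom.card]

section LocalField

variable (p : ℕ) [Fact (Nat.Prime p)]
  (k : Type) [Field k] [Algebra ℚ_[p] k] [FiniteDimensional ℚ_[p] k]

theorem absk_eq_spectralNorm_pow (x : k) :
    absk p k x = spectralNorm ℚ_[p] k x ^ finrank ℚ_[p] k :=
  norm_algebraNorm_eq_spectralNorm_pow ℚ_[p] k x

theorem absk_norm_rpow_eq_spectralNorm_pow (L : Type*) [Field L] [Algebra ℚ_[p] L] [Algebra k L]
    [IsScalarTower ℚ_[p] k L] [FiniteDimensional k L] (x : L) :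
    absk p k (Algebra.norm k x) ^ ((finrank k L : ℝ)⁻¹) =
      spectralNorm ℚ_[p] L x ^ finrank ℚ_[p] k := by
  have := FiniteDimensional.trans ℚ_[p] k L
  rw [absk, Algebra.norm_norm, norm_algebraNorm_eq_spectralNorm_pow,
    ← finrank_mul_finrank ℚ_[p] k L, pow_mul]
  exact Real.pow_rpow_inv_natCast (pow_nonneg (spectralNorm_nonneg x) _) finrank_pos.ne'

theorem kTop_eq_spectralNorm_topology :
    kTop p k = (spectralNorm.uniformSpace ℚ_[p] k).toTopologicalSpace := by
  let := spectralNorm.normedField ℚ_[p] k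
  have h := induced_eq_generateFrom_norm_pow (id : k → k)
    (finrank_pos (R := ℚ_[p]) (M := k)).ne'
  rw [induced_id] at h
  refine Eq.trans ?_ h.symm
  simp only [kTop, normTopology, absk_eq_spectralNorm_pow]
  rfl

variable (K : Type) [Field K] [Algebra k K] (Kn : ℕ → IntermediateField k K)
  (T : ℕ → K →ₗ[k] K)

theorem projTop_eq_iInf_induced [∀ n, FiniteDimensional k (Kn n)]
    [∀ n, Algebra ℚ_[p] (Kn n)] [∀ n, IsScalarTower ℚ_[p] k (Kn n)]
    [∀ n, Algebra.IsAlgebraic ℚ_[p] (Kn n)] (Knorm : K → ℝ)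
    (hKnorm : ∀ (n : ℕ) (x : K) (hx : x ∈ Kn n),
      Knorm x = absk p k (Algebra.norm k (⟨x, hx⟩ : Kn n)) ^ ((finrank k (Kn n) : ℝ)⁻¹)) :
    projTop k K Kn T Knorm =
      ⨅ n, TopologicalSpace.induced (fun x : ProjLim k K Kn T => (⟨x.1 n, x.2.1 n⟩ : Kn n))
        (spectralNorm.uniformSpace ℚ_[p] (Kn n)).toTopologicalSpace := by
  have hset : {U | ∃ x : ProjLim k K Kn T, ∃ n : ℕ, ∃ ε : ℝ, 0 < ε ∧
        U = {y : ProjLim k K Kn T | Knorm (y.1 n - x.1 n) < ε}} =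
      ⋃ n, {U | ∃ x : ProjLim k K Kn T, ∃ ε : ℝ, 0 < ε ∧
        U = {y : ProjLim k K Kn T | Knorm (y.1 n - x.1 n) < ε}} := by
    ext U
    simp only [Set.mem_ofPred_eq, Set.mem_iUnion]
    exact exists_comm
  rw [projTop, hset, generateFrom_iUnion]
  refine iInf_congr fun n => ?_
  let := spectralNorm.normedField ℚ_[p] (Kn n)
  have h := induced_eq_generateFrom_norm_pow
    (fun x : ProjLim k K Kn T => (⟨x.1 n, x.2.1 n⟩ : Kn n))
    (finrank_pos (R := ℚ_[p]) (M := k)).ne'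
  refine Eq.trans ?_ h.symm
  have hnorm (x y : ProjLim k K Kn T) : Knorm (y.1 n - x.1 n) =
      ‖(⟨y.1 n, y.2.1 n⟩ : Kn n) - ⟨x.1 n, x.2.1 n⟩‖ ^ finrank ℚ_[p] k :=
    (hKnorm n _ (sub_mem (y.2.1 n) (x.2.1 n))).trans
      (absk_norm_rpow_eq_spectralNorm_pow p k (Kn n) _)
  simp_rw [hnorm]

end LocalField

/-- The functional `w ↦ [E : k]⁻¹ Tr(a w)` on a finite extension `E` of `k`. -/
noncomputable def normalizedTraceMul (k E : Type*) [Field k] [Field E] [Algebra k E] (a : E) : E →ₗ[k] k :=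
  (finrank k E : k)⁻¹ • Algebra.trace k E ∘ₗ LinearMap.mulLeft k a

theorem eq_zero_of_normalizedTraceMul_basis {k E ι : Type*} [Field k] [CharZero k] [Field E]
    [Algebra k E] [FiniteDimensional k E] (b : Basis ι k E) (w : E)
    (h : ∀ i, normalizedTraceMul k E (b i) w = 0) : w = 0 := by
  have hn : (finrank k E : k)⁻¹ ≠ 0 := inv_ne_zero (Nat.cast_ne_zero.2 finrank_pos.ne')
  refine (traceForm_nondegenerate k E).1 w fun v => ?_
  have hv : (Algebra.traceForm k E w) = 0 := b.ext fun i => by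
    have := h i
    simp only [normalizedTraceMul, LinearMap.smul_apply, LinearMap.comp_apply,
      LinearMap.mulLeft_apply, smul_eq_mul, mul_eq_zero, hn, false_or] at this
    rw [Algebra.traceForm_apply, mul_comm, this, LinearMap.zero_apply]
  rw [hv, LinearMap.zero_apply]


theorem statement_5
    (p : ℕ) [Fact (Nat.Prime p)]
    (k : Type) [Field k] [Algebra ℚ_[p] k] [FiniteDimensional ℚ_[p] k]
    (K : Type) [Field K] [Algebra k K] [CharZero K]
    (Kn : ℕ → IntermediateField k K)
    (hbot : Kn 1 = ⊥) (hmono : Monotone Kn)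
    [hfd : ∀ n, FiniteDimensional k (Kn n)]
    (hunion : ∀ x : K, ∃ n, x ∈ Kn n)
    (T : ℕ → K →ₗ[k] K)
    (hTmem : ∀ (n : ℕ) (x : K), T n x ∈ Kn n)
    (hTdef : ∀ (n ν : ℕ) (h : n ≤ ν) (x : K) (hx : x ∈ Kn ν),
      T n x = ((finrank k (Kn n) : K) / (finrank k (Kn ν) : K)) *
        (relTrace k K (Kn n) (Kn ν) (hmono h) ⟨x, hx⟩ : K))
    (Knorm : K → ℝ)
    (hKnorm : ∀ (n : ℕ) (x : K) (hx : x ∈ Kn n),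
      Knorm x = absk p k (Algebra.norm k (⟨x, hx⟩ : Kn n)) ^ ((finrank k (Kn n) : ℝ)⁻¹))
    (pairing : K → ProjLim k K Kn T → k)
    (hpair : ∀ (n : ℕ) (a : K) (ha : a ∈ Kn n) (x : ProjLim k K Kn T),
      pairing a x = (finrank k (Kn n) : k)⁻¹ *
        Algebra.trace k (Kn n) (⟨a * x.1 n, mul_mem ha (x.2.1 n)⟩ : Kn n))
    :
    @borel _ (projTop k K Kn T Knorm) = @borel _ (weakTop p k K Kn T pairing) ∧
    @borel _ (projTop k K Kn T Knorm) =
      ⨆ (φ : ProjLim k K Kn T → k)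
        (_ : (∀ x y, φ (pladd k K Kn T x y) = φ x + φ y) ∧
             (∀ (c : k) (x : ProjLim k K Kn T), φ (plsmul k K Kn T c x) = c * φ x) ∧
             @Continuous _ _ (projTop k K Kn T Knorm) (kTop p k) φ),
        MeasurableSpace.comap φ (@borel k (kTop p k)) := by
  have hchar : CharZero k := charZero_of_injective_algebraMap (algebraMap ℚ_[p] k).injective
  let (n : ℕ) : Algebra ℚ_[p] (Kn n) :=
    ((algebraMap k (Kn n)).comp (algebraMap ℚ_[p] k)).toAlgebra
  have (n : ℕ) : IsScalarTower ℚ_[p] k (Kn n) := IsScalarTower.of_algebraMap_eq fun _ => rfl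
  have (n : ℕ) : FiniteDimensional ℚ_[p] (Kn n) := FiniteDimensional.trans ℚ_[p] k (Kn n)
  let := spectralNorm.normedAddCommGroup ℚ_[p] k
  let := spectralNorm.normedSpace ℚ_[p] k
  let (n : ℕ) := spectralNorm.normedAddCommGroup ℚ_[p] (Kn n)
  let (n : ℕ) := spectralNorm.normedSpace ℚ_[p] (Kn n)
  have : ProperSpace k := FiniteDimensional.proper ℚ_[p] k
  let f (n : ℕ) (x : ProjLim k K Kn T) : Kn n := ⟨x.1 n, x.2.1 n⟩
  let b (n : ℕ) (i : Fin (finrank k (Kn n))) : K := finBasis k (Kn n) i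
  let L (n : ℕ) (a : K) : Kn n →ₗ[ℚ_[p]] k :=
    if ha : a ∈ Kn n then (normalizedTraceMul k (Kn n) ⟨a, ha⟩).restrictScalars ℚ_[p] else 0
  have hL (n : ℕ) (a : K) (ha : a ∈ Kn n) (w : Kn n) :
      L n a w = normalizedTraceMul k (Kn n) ⟨a, ha⟩ w := by
    simp only [L, dif_pos ha]
    rfl
  have hpairL (n : ℕ) (a : K) (ha : a ∈ Kn n) (x : ProjLim k K Kn T) :
      pairing a x = L n a (f n x) := by
    rw [hL n a ha, hpair n a ha]
    rfl
  have hb (n : ℕ) (i) (x : ProjLim k K Kn T) : pairing (b n i) x = L n (b n i) (f n x) :=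
    hpairL n _ (finBasis k (Kn n) i).2 x
  have hsep (n : ℕ) (w : Kn n) (hw : ∀ i, L n (b n i) w = 0) : w = 0 :=
    eq_zero_of_normalizedTraceMul_basis (finBasis k (Kn n)) w fun i =>
      (hL n _ (finBasis k (Kn n) i).2 w).symm.trans (hw i)
  have hproj := projTop_eq_iInf_induced p k K Kn T Knorm hKnorm
  have hk := kTop_eq_spectralNorm_topology p k
  have hweak : projTop k K Kn T Knorm = weakTop p k K Kn T pairing := by
    rw [hproj, weakTop, hk]
    exact iInf_induced_eq_iInf_pairing f pairing b L hb hsep fun a =>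
      (hunion a).imp fun n ha => hpairL n a ha
  refine ⟨by rw [hweak], le_antisymm ?_ (iSup₂_le fun φ hφ => ?_)⟩
  · have hle := borel_iInf_induced_le_iSup_comap f pairing b L hb hsep
    rw [hproj]
    refine hle.trans (iSup_le fun a => ?_)
    obtain ⟨n, ha⟩ := hunion a
    rw [← hproj, hk]
    refine le_iSup₂_of_le (pairing a) ⟨fun x y => ?_, fun c x => ?_, ?_⟩ le_rfl
    · simp only [hpairL n a ha, hL n a ha]
      exact map_add (normalizedTraceMul k (Kn n) ⟨a, ha⟩) (f n x) (f n y)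
    · simp only [hpairL n a ha, hL n a ha]
      exact map_smul (normalizedTraceMul k (Kn n) ⟨a, ha⟩) c (f n x)
    · rw [hweak, weakTop, hk, continuous_iff_le_induced]
      exact iInf_le _ a
  · rw [← borel_comap]
    exact borel_anti hφ.2.2.le_induced
end

section
/- For every n ≥ 1 and every φ ∈ L¹(K_n) (with respect to the normalized Haar measure on K_n), the function f(x) = φ(T_n(x)) is μ-integrable and ∫_{K̄} f(x) dμ(x) = q_n^{−d_n}·‖m_n‖^{−m_n}·∫_{{z ∈ K_n : ‖z‖ ≤ q_n^{d_n/m_n}·‖m_n‖}} φ(z) dz. -/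
open MeasureTheory Module
open scoped Classical

section
open scoped Pointwise

theorem spectralNorm_pow_finrank (F L : Type) [NontriviallyNormedField F] [CompleteSpace F]
    [IsUltrametricDist F] [Field L] [Algebra F L] [FiniteDimensional F L] (x : L) :
    spectralNorm F L x ^ finrank F L = ‖Algebra.norm F x‖ := by
  have hx : IsIntegral F x := Algebra.IsIntegral.isIntegral x
  have hn : (minpoly F x).natDegree ≠ 0 := (minpoly.natDegree_pos hx).ne'
  have hgen : ‖Algebra.norm F (IntermediateField.AdjoinSimple.gen F x)‖ =
      ‖(minpoly F x).coeff 0‖ := by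
    rw [← IntermediateField.adjoin.powerBasis_gen hx,
      Algebra.PowerBasis.norm_gen_eq_coeff_zero_minpoly, IntermediateField.adjoin.powerBasis_gen,
      IntermediateField.minpoly_gen]
    simp
  rw [Algebra.norm_eq_norm_adjoin, norm_pow, hgen,
    ← finrank_mul_finrank F (IntermediateField.adjoin F {x}) L,
    IntermediateField.adjoin.finrank hx, pow_mul, spectralNorm.spectralNorm_eq_norm_coeff_zero_rpow,
    one_div, Real.rpow_inv_natCast_pow (norm_nonneg _) hn]

theorem Measure.ext_of_integral_monoidHom_eq {E S : Type} [PseudoEMetricSpace E] [MeasurableSpace E]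
    [BorelSpace E] [CompleteSpace E] [SecondCountableTopology E] [Group S]
    (f : S →* (BoundedContinuousFunction E ℂ)) (hstar : ∀ s, star (f s) = f s⁻¹)
    (hsep : ∀ x y : E, x ≠ y → ∃ s, f s x ≠ f s y)
    {P P' : Measure E} [IsFiniteMeasure P] [IsFiniteMeasure P']
    (h : ∀ s, ∫ x, f s x ∂P = ∫ x, f s x ∂P') : P = P' := by
  refine ext_of_forall_mem_subalgebra_integral_eq_of_pseudoEMetric_complete_countable
    (A := StarAlgebra.adjoin ℂ (Set.range f)) ?_ ?_
  · intro x y hxy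
    obtain ⟨s, hs⟩ := hsep x y hxy
    refine ⟨f s, ⟨BoundedContinuousFunction.toContinuousMapStarₐ ℂ (f s),
      ⟨f s, StarAlgebra.subset_adjoin _ _ ⟨s, rfl⟩, rfl⟩, rfl⟩, hs⟩
  · intro g hg
    have hst : star (Set.range f) = Set.range f := by
      ext g
      constructor
      · rintro ⟨s, hs⟩
        exact ⟨s⁻¹, by rw [← hstar, hs, star_star]⟩
      · rintro ⟨s, rfl⟩
        exact ⟨s⁻¹, (hstar s).symm⟩
    have hg' : g ∈ Submodule.span ℂ (Set.range f) := by
      have h1 : g ∈ (StarAlgebra.adjoin ℂ (Set.range f)).toSubalgebra := hg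
      rw [StarAlgebra.adjoin_toSubalgebra, hst, Set.union_self,
        ← Subalgebra.mem_toSubmodule, Algebra.adjoin_eq_span, ← MonoidHom.coe_mrange,
        Submonoid.closure_eq] at h1
      exact h1
    clear hg
    induction hg' using Submodule.span_induction with
    | mem g hg => obtain ⟨s, rfl⟩ := hg; exact h s
    | zero => simp
    | add g g' hg hg' ih ih' =>
      simp only [BoundedContinuousFunction.coe_add, Pi.add_apply]
      rw [integral_add (g.integrable P) (g'.integrable P),
        integral_add (g.integrable P') (g'.integrable P'), ih, ih']
    | smul c g hg ih =>
      simp only [BoundedContinuousFunction.coe_smul, integral_smul, ih]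

theorem integral_closedBall_char_eq_zero {L : Type} [NormedField L] [IsUltrametricDist L]
    [MeasurableSpace L] [BorelSpace L] (vol : Measure L) [vol.IsAddRightInvariant]
    (ψ : L → ℂ) (hadd : ∀ x y, ψ (x + y) = ψ x * ψ y) (r : ℝ) (b : L) (hb : ‖b‖ ≤ r)
    (hψ : ψ b ≠ 1) : ∫ z in Metric.closedBall (0 : L) r, ψ z ∂vol = 0 := by
  have hB : MeasurableSet (Metric.closedBall (0 : L) r) := Metric.isClosed_closedBall.measurableSet
  have hmem : ∀ z, z + b ∈ Metric.closedBall (0 : L) r ↔ z ∈ Metric.closedBall (0 : L) r := by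
    intro z
    simp only [mem_closedBall_zero_iff]
    refine ⟨fun h => ?_, fun h => (IsUltrametricDist.norm_add_le_max z b).trans (max_le h hb)⟩
    simpa using (IsUltrametricDist.norm_add_le_max (z + b) (-b)).trans
      (max_le h (by rwa [norm_neg]))
  have key : ∫ z in Metric.closedBall (0 : L) r, ψ z ∂vol =
      (∫ z in Metric.closedBall (0 : L) r, ψ z ∂vol) * ψ b := by
    rw [← integral_indicator hB]
    conv_lhs => rw [← integral_add_right_eq_self _ b]
    rw [← integral_mul_const]
    congr 1
    ext z
    simp only [Set.indicator_apply, hmem, hadd]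
    split_ifs <;> simp
  by_contra h0
  exact hψ (mul_left_cancel₀ h0 (by rw [← key, mul_one]))

theorem distribHaarChar_units_eq_one {L : Type} [NormedField L] [ProperSpace L] (u : Lˣ)
    (hu : ‖(u : L)‖ = 1) : distribHaarChar L u = 1 := by
  borelize L
  refine distribHaarChar_eq_of_measure_smul_eq_mul (μ := Measure.addHaar)
    (s := Metric.closedBall (0 : L) 1) ?_ ?_ ?_
  · exact (Metric.measure_closedBall_pos _ _ one_pos).ne'
  · exact (isCompact_closedBall _ _).measure_ne_top
  · have : u • Metric.closedBall (0 : L) 1 = Metric.closedBall (0 : L) 1 := by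
      ext z
      rw [Set.mem_smul_set_iff_inv_smul_mem]
      simp [Units.smul_def, hu]
    rw [this]; simp

theorem distribHaarChar_prime (p : ℕ) [Fact p.Prime] {L : Type} [NormedField L]
    [NormedAlgebra ℚ_[p] L] [FiniteDimensional ℚ_[p] L] [ProperSpace L] (u : Lˣ)
    (hu : (u : L) = p) : distribHaarChar L u = ((p : NNReal)⁻¹) ^ finrank ℚ_[p] L := by
  borelize L
  have hp : p.Prime := Fact.out
  let e := ContinuousLinearEquiv.ofFinrankEq (𝕜 := ℚ_[p]) (E := L) (F := Fin (finrank ℚ_[p] L) → ℚ_[p])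
    (by simp)
  let S : Set L := e ⁻¹' Metric.closedBall 0 1
  have hSc : IsCompact S := e.toHomeomorph.isCompact_preimage.2 (isCompact_closedBall _ _)
  have hS0 : (Measure.addHaar S) ≠ 0 := by
    have : IsOpen (e ⁻¹' Metric.ball 0 1) := Metric.isOpen_ball.preimage e.continuous
    refine ((this.measure_pos Measure.addHaar ⟨0, by simp⟩).trans_le (measure_mono ?_)).ne'
    exact Set.preimage_mono Metric.ball_subset_closedBall
  have hpS : u • S = e ⁻¹' {v | ∀ i, ‖v i‖ < 1} := by
    ext z
    rw [Set.mem_smul_set_iff_inv_smul_mem]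
    have h1 : u⁻¹ • z = (p : ℚ_[p])⁻¹ • z := by
      rw [Units.smul_def, smul_eq_mul, Algebra.smul_def]; simp [hu]
    simp only [S, Set.mem_preimage, h1, map_smul, mem_closedBall_zero_iff, Set.mem_ofPred_eq,
      pi_norm_le_iff_of_nonneg zero_le_one, Pi.smul_apply]
    refine forall_congr' fun i => ?_
    have h2 := Padic.norm_lt_pow_iff_norm_le_pow_sub_one (e z i) 0
    rw [zpow_zero, zero_sub, zpow_neg_one] at h2
    rw [norm_smul, norm_inv, Padic.norm_p, inv_inv, h2, ← le_inv_mul_iff₀ (by exact_mod_cast hp.pos),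
      mul_one]
  let a : (Fin (finrank ℚ_[p] L) → Fin p) → L := fun f => e.symm fun i => ((f i : ℕ) : ℚ_[p])
  have hU : S = ⋃ f, (fun z => -a f + z) ⁻¹' (u • S) := by
    ext z
    simp only [hpS, S, Set.mem_preimage, mem_closedBall_zero_iff,
      pi_norm_le_iff_of_nonneg zero_le_one, Set.mem_iUnion, map_add, map_neg, a,
      ContinuousLinearEquiv.apply_symm_apply, Set.mem_ofPred_eq, Pi.add_apply, Pi.neg_apply]
    constructor
    · intro h
      have hf (i : Fin (finrank ℚ_[p] L)) : ∃ n : Fin p, ‖-((n : ℕ) : ℚ_[p]) + e z i‖ < 1 := by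
        obtain ⟨y, hy⟩ : ∃ y : ℤ_[p], (y : ℚ_[p]) = e z i := ⟨⟨e z i, h i⟩, rfl⟩
        obtain ⟨n, hn, hn'⟩ := PadicInt.exists_mem_range y
        refine ⟨⟨n, hn⟩, ?_⟩
        rw [PadicInt.maximalIdeal_eq_span_p, Ideal.mem_span_singleton,
          ← PadicInt.norm_lt_one_iff_dvd, PadicInt.norm_def, PadicInt.coe_sub,
          PadicInt.coe_natCast, hy] at hn'
        rw [neg_add_eq_sub]
        exact hn'
      choose f hf using hf
      exact ⟨f, hf⟩
    · rintro ⟨f, hf⟩ i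
      have := (Padic.nonarchimedean (((f i : ℕ) : ℚ_[p])) (-((f i : ℕ) : ℚ_[p]) + e z i)).trans
        (max_le (by simpa using Padic.norm_int_le_one (p := p) (f i : ℤ)) (hf i).le)
      simpa using this
  have hd : Pairwise (Function.onFun Disjoint fun f => (fun z => -a f + z) ⁻¹' (u • S)) := by
    intro f g hfg
    rw [Function.onFun, Set.disjoint_left]
    intro z hz hz'
    apply hfg
    simp only [hpS, Set.mem_preimage, map_add, map_neg, a,
      ContinuousLinearEquiv.apply_symm_apply, Set.mem_ofPred_eq, Pi.add_apply, Pi.neg_apply] at hz hz'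
    ext i
    have h1 : ‖(((g i : ℤ) - (f i : ℤ) : ℤ) : ℚ_[p])‖ < 1 := by
      have := (Padic.nonarchimedean (-((f i : ℕ) : ℚ_[p]) + e z i)
        (-(-((g i : ℕ) : ℚ_[p]) + e z i))).trans_lt
        (max_lt (hz i) (by rw [norm_neg]; exact hz' i))
      have h2 : (((g i : ℤ) - (f i : ℤ) : ℤ) : ℚ_[p]) =
          -((f i : ℕ) : ℚ_[p]) + e z i + -(-((g i : ℕ) : ℚ_[p]) + e z i) := by
        push_cast; ring
      rwa [h2]
    rw [Padic.norm_intCast_lt_one_iff] at h1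
    have := (f i).2
    have := (g i).2
    obtain ⟨c, hc⟩ := h1
    have hc0 : c = 0 := by
      by_contra h0
      rcases lt_or_gt_of_ne h0 with h | h <;> nlinarith
    subst hc0
    lia
  have hm : MeasurableSet (u • S) := (hSc.smul u).isClosed.measurableSet
  have hmeas : Measure.addHaar S = (p : ENNReal) ^ finrank ℚ_[p] L * Measure.addHaar (u • S) := by
    conv_lhs => rw [hU]
    rw [measure_iUnion hd fun f => hm.preimage (measurable_const_add _)]
    simp [measure_preimage_add]
  refine distribHaarChar_eq_of_measure_smul_eq_mul (μ := Measure.addHaar)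
    (s := S) hS0 hSc.measure_ne_top ?_
  rw [hmeas, ← mul_assoc, ENNReal.coe_pow, ENNReal.coe_inv (by exact_mod_cast hp.ne_zero), ← mul_pow,
    ENNReal.coe_natCast, ENNReal.inv_mul_cancel (by exact_mod_cast hp.ne_zero)
      (ENNReal.natCast_ne_top p), one_pow, one_mul]

theorem measure_closedBall_eq_norm_pow (p : ℕ) [Fact p.Prime] {L : Type} [NormedField L]
    [NormedAlgebra ℚ_[p] L] [FiniteDimensional ℚ_[p] L] [ProperSpace L]
    [MeasurableSpace L] [BorelSpace L] (vol : Measure L) [vol.IsAddHaarMeasure] (t : L) (ht : t ≠ 0) :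
    vol (Metric.closedBall 0 ‖t‖) =
      ENNReal.ofReal (‖t‖ ^ finrank ℚ_[p] L) * vol (Metric.closedBall 0 1) := by
  have hp0 : (p : L) ≠ 0 := by
    have : (p : ℚ_[p]) ≠ 0 := by exact_mod_cast (Fact.out : p.Prime).ne_zero
    simpa using (map_ne_zero (algebraMap ℚ_[p] L)).2 this
  have hpn : ‖(p : L)‖ = (p : ℝ)⁻¹ := by
    rw [← Padic.norm_p (p := p), ← norm_algebraMap' L (p : ℚ_[p]), map_natCast]
  set N := finrank ℚ_[p] L with hN
  have hN0 : N ≠ 0 := finrank_pos.ne'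
  obtain ⟨j, hj⟩ : ∃ j : ℤ, ‖t‖ ^ N = ‖(p : L)‖ ^ j := by
    have h1 := spectralNorm_pow_finrank ℚ_[p] L t
    rw [← NormedAlgebra.norm_eq_spectralNorm] at h1
    obtain ⟨j, hj⟩ := Padic.padicNormE.image (p := p) ((Algebra.norm_ne_zero_iff (R := ℚ_[p])).2 ht)
    exact ⟨j, by rw [h1, hpn, hj, inv_zpow']; push_cast; rfl⟩
  let pu : Lˣ := Units.mk0 _ hp0
  let tu : Lˣ := Units.mk0 _ ht
  have hδ : distribHaarChar L tu = ‖t‖₊ ^ N := by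
    have h1 := distribHaarChar_units_eq_one (tu ^ N * (pu ^ j)⁻¹) (by
      have := zpow_ne_zero j (norm_ne_zero_iff.2 hp0)
      simp [tu, pu, hj, this])
    rw [map_mul, map_inv, mul_inv_eq_one₀ distribHaarChar_pos.ne', map_pow, map_zpow,
      distribHaarChar_prime p pu rfl] at h1
    refine (pow_left_inj₀ zero_le zero_le hN0).1 ?_
    rw [h1, ← NNReal.coe_inj]
    push_cast
    rw [hj, ← hpn, ← zpow_natCast, ← zpow_natCast, zpow_comm]
  have := distribHaarChar_mul vol tu (Metric.closedBall 0 1)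
  rw [hδ] at this
  have hball : tu • Metric.closedBall (0 : L) 1 = Metric.closedBall 0 ‖t‖ := by
    ext z
    rw [Set.mem_smul_set_iff_inv_smul_mem]
    simp only [mem_closedBall_zero_iff, Units.smul_def, smul_eq_mul, tu, Units.val_inv_eq_inv_val,
      Units.val_mk0, norm_mul, norm_inv]
    rw [inv_mul_le_iff₀ (norm_pos_iff.2 ht), mul_one]
  rw [← hball, ← this, ENNReal.ofReal_pow (norm_nonneg _), ofReal_norm]
  simp [enorm]

theorem eq_smul_restrict_closedBall (p : ℕ) [Fact p.Prime] {L : Type} [NormedField L]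
    [NormedAlgebra ℚ_[p] L] [FiniteDimensional ℚ_[p] L] [IsUltrametricDist L]
    [MeasurableSpace L] [BorelSpace L] (vol : Measure L) [vol.IsAddLeftInvariant]
    (hvol : vol (Metric.closedBall 0 1) = 1) (ψ : L → ℂ) (hψadd : ∀ x y, ψ (x + y) = ψ x * ψ y)
    (hψnorm : ∀ x, ‖ψ x‖ = 1) (hψcont : Continuous ψ) (t : L) (ht : t ≠ 0)
    (hψ : ∀ z, ‖z‖ ≤ ‖t‖ ↔ ∀ a, ‖a‖ ≤ 1 → ψ (a * z) = 1)
    (ν : Measure L) [IsFiniteMeasure ν]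
    (hν : ∀ a, ∫ z, ψ (a * z) ∂ν = if ‖a‖ ≤ 1 then 1 else 0) :
    ν = ENNReal.ofReal ((‖t‖ ^ finrank ℚ_[p] L)⁻¹) •
      vol.restrict (Metric.closedBall 0 ‖t‖) := by
  have : ProperSpace L := FiniteDimensional.proper ℚ_[p] L
  have hψ0 : ψ 0 = 1 := by simpa using (hψ 0).1 (by simp) 0 (by simp)
  have hHaar : vol.IsAddHaarMeasure :=
    Measure.isAddHaarMeasure_of_isCompact_nonempty_interior vol (Metric.closedBall 0 1)
      (isCompact_closedBall _ _)
      ⟨0, mem_interior_iff_mem_nhds.2 (Metric.closedBall_mem_nhds 0 one_pos)⟩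
      (by simp [hvol]) (by simp [hvol])
  have hB := measure_closedBall_eq_norm_pow p vol t ht
  rw [hvol, mul_one] at hB
  have htn : 0 < ‖t‖ ^ finrank ℚ_[p] L := pow_pos (norm_pos_iff.2 ht) _
  have hpair (a : L) : Continuous fun z => ψ (a * z) := hψcont.comp (continuous_const_mul a)
  let f : Multiplicative L →* BoundedContinuousFunction L ℂ :=
    { toFun := fun a => BoundedContinuousFunction.ofNormedAddCommGroup
        (fun z => ψ (a.toAdd * z)) (hpair _) 1 fun z => (hψnorm _).le
      map_one' := by ext; simp [hψ0]
      map_mul' := fun a b => by ext; simp [add_mul, hψadd] }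
  have hf (a : Multiplicative L) (z : L) : f a z = ψ (a.toAdd * z) := rfl
  have hfin : IsFiniteMeasure (ENNReal.ofReal ((‖t‖ ^ finrank ℚ_[p] L)⁻¹) •
      vol.restrict (Metric.closedBall (0 : L) ‖t‖)) :=
    ⟨by
      rw [Measure.smul_apply, Measure.restrict_apply_univ, hB, smul_eq_mul]
      exact ENNReal.mul_lt_top ENNReal.ofReal_lt_top ENNReal.ofReal_lt_top⟩
  refine Measure.ext_of_integral_monoidHom_eq f ?_ ?_ ?_
  · intro a
    ext z
    simp only [BoundedContinuousFunction.star_apply, hf, toAdd_inv, neg_mul]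
    have h1 : ψ (a.toAdd * z) * ψ (-(a.toAdd * z)) = 1 := by rw [← hψadd, add_neg_cancel, hψ0]
    rw [← inv_eq_of_mul_eq_one_right h1, Complex.inv_def, Complex.normSq_eq_norm_sq, hψnorm]
    simp
  · intro x y hxy
    by_contra! h
    simp only [hf] at h
    have hxy' : x - y ≠ 0 := sub_ne_zero.2 hxy
    have h1 (a : L) : ψ (a * (x - y)) = 1 := by
      have h2 := h (Multiplicative.ofAdd a)
      simp only [toAdd_ofAdd] at h2
      have h3 := hψadd (a * (x - y)) (a * y)
      rw [← mul_add, sub_add_cancel, h2] at h3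
      have h4 : ψ (a * y) ≠ 0 := norm_ne_zero_iff.1 (by simp [hψnorm])
      exact (mul_right_cancel₀ h4 (by rw [one_mul]; exact h3)).symm
    obtain ⟨c, hc⟩ := NormedField.exists_lt_norm ℚ_[p] ‖t‖
    refine hc.not_ge ?_
    rw [← norm_algebraMap' L c]
    refine (hψ _).2 fun a _ => ?_
    have := h1 (a * algebraMap ℚ_[p] L c * (x - y)⁻¹)
    rwa [inv_mul_cancel_right₀ hxy'] at this
  · intro a
    simp only [hf, hν, integral_smul_measure]
    generalize a.toAdd = a
    split_ifs with ha
    · rw [setIntegral_congr_fun (g := fun _ => 1) Metric.isClosed_closedBall.measurableSet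
        fun z hz => (hψ z).1 (mem_closedBall_zero_iff.1 hz) a ha]
      rw [setIntegral_const, measureReal_def, hB, ENNReal.toReal_ofReal htn.le,
        ENNReal.toReal_ofReal (inv_nonneg.2 htn.le), smul_smul, inv_mul_cancel₀ htn.ne', one_smul]
    · have : ¬ ‖a * t‖ ≤ ‖t‖ := by
        rw [norm_mul, not_le]
        exact lt_mul_of_one_lt_left (norm_pos_iff.2 ht) (not_le.1 ha)
      rw [hψ] at this
      push Not at this
      obtain ⟨b, hb, hb'⟩ := this
      rw [integral_closedBall_char_eq_zero vol (fun z => ψ (a * z))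
        (fun x y => by rw [mul_add, hψadd]) _ (b * t) ?_ ?_, smul_zero]
      · rw [norm_mul]
        exact mul_le_of_le_one_left (norm_nonneg _) hb
      · rwa [mul_left_comm]

theorem induced_normTopology_eq {X L : Type} [AddCommGroup X] [SeminormedAddCommGroup L]
    (ι : L →+ X) (f : X → ℝ) (hf : ∀ x y, f (x + y) ≤ max (f x) (f y)) (s : ℕ) (hs : s ≠ 0)
    (hι : ∀ z, f (ι z) = ‖z‖ ^ s) :
    TopologicalSpace.induced ι (normTopology f) = UniformSpace.toTopologicalSpace := by
  rw [normTopology, induced_generateFrom_eq]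
  apply le_antisymm
  · intro U hU
    let := TopologicalSpace.generateFrom
      ((ι ⁻¹' ·) '' {U | ∃ x : X, ∃ ε : ℝ, 0 < ε ∧ U = {y : X | f (y - x) < ε}})
    refine isOpen_iff_forall_mem_open.2 fun z hz => ?_
    obtain ⟨ε, hε, hε'⟩ := Metric.isOpen_iff.1 hU z hz
    refine ⟨ι ⁻¹' {y | f (y - ι z) < ε ^ s}, fun w hw => hε' ?_,
      TopologicalSpace.isOpen_generateFrom_of_mem ⟨_, ⟨ι z, ε ^ s, by positivity, rfl⟩, rfl⟩, ?_⟩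
    · simp only [Set.mem_preimage, Set.mem_ofPred_eq, ← map_sub, hι] at hw
      rw [mem_ball_iff_norm]
      exact lt_of_pow_lt_pow_left₀ s hε.le hw
    · change f (ι z - ι z) < ε ^ s
      rw [← map_sub, hι, sub_self, norm_zero, zero_pow hs]
      positivity
  · refine le_generateFrom ?_
    rintro _ ⟨_, ⟨x, ε, hε, rfl⟩, rfl⟩
    rw [Metric.isOpen_iff]
    intro z hz
    obtain ⟨δ, hδ, hδ'⟩ : ∃ δ : ℝ, 0 < δ ∧ δ ^ s ≤ ε :=
      ⟨min ε 1, by positivity, (pow_le_of_le_one (by positivity) (min_le_right _ _) hs).trans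
        (min_le_left _ _)⟩
    refine ⟨δ, hδ, fun w hw => ?_⟩
    simp only [Set.mem_preimage, Set.mem_ofPred_eq] at hz ⊢
    have h1 := hf (ι (w - z)) (ι z - x)
    rw [map_sub, sub_add_sub_cancel] at h1
    refine h1.trans_lt (max_lt ?_ hz)
    rw [← map_sub, hι]
    rw [mem_ball_iff_norm] at hw
    exact (pow_lt_pow_left₀ hw (norm_nonneg _) hs).trans_le hδ'

theorem absk_mul (p : ℕ) [Fact p.Prime] (k : Type) [Field k] [Algebra ℚ_[p] k]
    [FiniteDimensional ℚ_[p] k] (x y : k) : absk p k (x * y) = absk p k x * absk p k y := by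
  simp [absk]

theorem absk_norm_rpow_eq (p : ℕ) [Fact p.Prime] (k L : Type) [Field k] [Algebra ℚ_[p] k]
    [FiniteDimensional ℚ_[p] k] [NormedField L] [NormedAlgebra ℚ_[p] L] [Algebra k L]
    [IsScalarTower ℚ_[p] k L] [FiniteDimensional k L] (x : L) :
    absk p k (Algebra.norm k x) ^ ((finrank k L : ℝ)⁻¹) = ‖x‖ ^ finrank ℚ_[p] k := by
  have : FiniteDimensional ℚ_[p] L := FiniteDimensional.trans ℚ_[p] k L
  rw [absk, Algebra.norm_norm, ← spectralNorm_pow_finrank, ← NormedAlgebra.norm_eq_spectralNorm,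
    ← finrank_mul_finrank ℚ_[p] k L, pow_mul,
    Real.pow_rpow_inv_natCast (by positivity) finrank_pos.ne']

theorem absk_norm_algebraMap_rpow (p : ℕ) [Fact p.Prime] (k L : Type) [Field k] [Algebra ℚ_[p] k]
    [FiniteDimensional ℚ_[p] k] [Field L] [Algebra k L] [FiniteDimensional k L] (c : k) :
    absk p k (Algebra.norm k (algebraMap k L c)) ^ ((finrank k L : ℝ)⁻¹) = absk p k c := by
  have h : absk p k (c ^ finrank k L) = absk p k c ^ finrank k L := by simp [absk]
  have h0 : 0 ≤ absk p k c := norm_nonneg _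
  rw [Algebra.norm_algebraMap, h, Real.pow_rpow_inv_natCast h0 finrank_pos.ne']

theorem isUltrametricDist_spectralNorm (F L : Type) [NontriviallyNormedField F] [CompleteSpace F]
    [IsUltrametricDist F] [Field L] [Algebra F L] [Algebra.IsAlgebraic F L] :
    @IsUltrametricDist L (spectralNorm.metricSpace F L).toDist := by
  let := spectralNorm.normedField F L
  exact IsUltrametricDist.isUltrametricDist_of_isNonarchimedean_norm
    (isNonarchimedean_spectralNorm (K := F) (L := L))

theorem absk_norm_rpow_add_le (p : ℕ) [Fact p.Prime] (k L : Type) [Field k] [Algebra ℚ_[p] k]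
    [FiniteDimensional ℚ_[p] k] [Field L] [Algebra k L] [FiniteDimensional k L] (x y : L) :
    absk p k (Algebra.norm k (x + y)) ^ ((finrank k L : ℝ)⁻¹) ≤
      max (absk p k (Algebra.norm k x) ^ ((finrank k L : ℝ)⁻¹))
        (absk p k (Algebra.norm k y) ^ ((finrank k L : ℝ)⁻¹)) := by
  let : Algebra ℚ_[p] L := ((algebraMap k L).comp (algebraMap ℚ_[p] k)).toAlgebra
  have : IsScalarTower ℚ_[p] k L := IsScalarTower.of_algebraMap_eq fun _ => rfl
  have : FiniteDimensional ℚ_[p] L := FiniteDimensional.trans ℚ_[p] k L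
  have := isUltrametricDist_spectralNorm ℚ_[p] L
  let := spectralNorm.normedField ℚ_[p] L
  let := spectralNorm.normedAlgebra ℚ_[p] L
  simp only [absk_norm_rpow_eq]
  rcases le_max_iff.1 (IsUltrametricDist.norm_add_le_max x y) with h | h
  · exact (pow_le_pow_left₀ (norm_nonneg _) h _).trans (le_max_left _ _)
  · exact (pow_le_pow_left₀ (norm_nonneg _) h _).trans (le_max_right _ _)

theorem absk_add_le (p : ℕ) [Fact p.Prime] (k : Type) [Field k] [Algebra ℚ_[p] k]
    [FiniteDimensional ℚ_[p] k] (x y : k) : absk p k (x + y) ≤ max (absk p k x) (absk p k y) := by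
  simpa using absk_norm_rpow_add_le p k k x y

theorem continuous_char_trace (p : ℕ) [Fact p.Prime] (k L : Type) [Field k] [Algebra ℚ_[p] k]
    [FiniteDimensional ℚ_[p] k] [NormedField L] [NormedAlgebra ℚ_[p] L] [Algebra k L]
    [IsScalarTower ℚ_[p] k L] [FiniteDimensional k L] (χ : k → ℂ)
    (hχ : @Continuous _ _ (kTop p k) _ χ) (c : k) :
    Continuous fun z : L => χ (c * Algebra.trace k L z) := by
  have : FiniteDimensional ℚ_[p] L := FiniteDimensional.trans ℚ_[p] k L
  let := spectralNorm.normedField ℚ_[p] k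
  let := spectralNorm.normedAlgebra ℚ_[p] k
  have htop : kTop p k = UniformSpace.toTopologicalSpace := by
    have h := induced_normTopology_eq (AddMonoidHom.id k) (absk p k) (absk_add_le p k)
      (finrank ℚ_[p] k) finrank_pos.ne' fun z => (spectralNorm_pow_finrank ℚ_[p] k z).symm
    exact (@induced_id k (kTop p k)).symm.trans h
  have htr : Continuous (Algebra.trace k L) :=
    ((Algebra.trace k L).restrictScalars ℚ_[p]).continuous_of_finiteDimensional
  have hmul : Continuous fun z : L => c * Algebra.trace k L z := continuous_const.mul htr
  rw [← htop] at hmul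
  exact @Continuous.comp _ _ _ _ (kTop p k) _ _ _ hχ hmul

theorem eq_smul_restrict_of_integral_char_trace (p : ℕ) [Fact p.Prime] (k L : Type) [Field k]
    [Algebra ℚ_[p] k] [FiniteDimensional ℚ_[p] k] [NormedField L] [NormedAlgebra ℚ_[p] L]
    [IsUltrametricDist L] [Algebra k L] [IsScalarTower ℚ_[p] k L] [FiniteDimensional k L]
    [MeasurableSpace L] [BorelSpace L] (vol : Measure L) [vol.IsAddLeftInvariant]
    (g : L → ℝ) (hg : ∀ x, g x = absk p k (Algebra.norm k x) ^ ((finrank k L : ℝ)⁻¹))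
    (hvol : vol {z | g z ≤ 1} = 1) (q d r : ℕ)
    (hq : IsGreatest {r : ℝ | (∃ x : L, g x ^ (finrank k L : ℝ) = r) ∧ r < 1} ((q : ℝ)⁻¹))
    (χ : k → ℂ) (hχadd : ∀ x y : k, χ (x + y) = χ x * χ y) (hχnorm : ∀ x : k, ‖χ x‖ = 1)
    (hχcont : @Continuous _ _ (kTop p k) _ χ) (hχtriv : ∀ x : k, absk p k x ≤ 1 → χ x = 1)
    (hr : ∀ x : k, 1 < absk p k x → (r : ℝ) ≤ absk p k x)
    (hχrank : ∃ x : k, absk p k x ≤ r ∧ χ x ≠ 1)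
    (hd : ∀ x : L, g x ^ (finrank k L : ℝ) ≤ (q : ℝ) ^ (d : ℝ) ↔
        ∀ y : L, g y ≤ 1 → absk p k (Algebra.trace k L (x * y)) ≤ 1)
    (ν : Measure L) [IsFiniteMeasure ν]
    (hν : ∀ a : L, ∫ z, χ ((finrank k L : k)⁻¹ * Algebra.trace k L (a * z)) ∂ν =
      if g a ≤ 1 then 1 else 0) :
    ν = ENNReal.ofReal (((q : ℝ) ^ d)⁻¹ * absk p k (finrank k L : k) ^ (-(finrank k L : ℤ))) •
      vol.restrict {z | g z ≤ (q : ℝ) ^ ((d : ℝ) / (finrank k L : ℝ)) *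
        absk p k (finrank k L : k)} := by
  have : FiniteDimensional ℚ_[p] L := FiniteDimensional.trans ℚ_[p] k L
  have : CharZero k := charZero_of_injective_algebraMap (algebraMap ℚ_[p] k).injective
  set m := finrank k L with hm
  have hm0 : m ≠ 0 := finrank_pos.ne'
  have hmk : (m : k) ≠ 0 := by exact_mod_cast hm0
  set D := finrank ℚ_[p] k with hD
  have hD0 : D ≠ 0 := finrank_pos.ne'
  have hgn (x : L) : g x = ‖x‖ ^ D := by rw [hg, absk_norm_rpow_eq]
  have hgc (c : k) : g (algebraMap k L c) = absk p k c := by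
    rw [hg, absk_norm_algebraMap_rpow]
  have hgmul (x y : L) : g (x * y) = g x * g y := by simp only [hgn, norm_mul, mul_pow]
  have hg0 (x : L) : 0 ≤ g x := by rw [hgn]; positivity
  have hgpos (x : L) (hx : x ≠ 0) : 0 < g x := by rw [hgn]; positivity
  have hgle (x y : L) : g x ≤ g y ↔ ‖x‖ ≤ ‖y‖ := by
    rw [hgn, hgn, pow_le_pow_iff_left₀ (norm_nonneg _) (norm_nonneg _) hD0]
  have hg1 (x : L) : g x ≤ 1 ↔ ‖x‖ ≤ 1 := by
    rw [hgn, pow_le_one_iff_of_nonneg (norm_nonneg _) hD0]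
  obtain ⟨⟨⟨ϖ, hϖ⟩, hq1⟩, hqmax⟩ := hq
  rw [Real.rpow_natCast] at hϖ
  have hq0 : (0 : ℝ) < (q : ℝ)⁻¹ := by
    have hp0 : (p : ℚ_[p]) ≠ 0 := by exact_mod_cast (Fact.out : p.Prime).ne_zero
    have h1 : algebraMap ℚ_[p] L p ≠ 0 := (map_ne_zero _).2 hp0
    have h2 : g (algebraMap ℚ_[p] L p) ^ (m : ℝ) < 1 := by
      rw [Real.rpow_natCast, hgn, norm_algebraMap', ← pow_mul]
      exact pow_lt_one₀ (norm_nonneg _) Padic.norm_p_lt_one (mul_ne_zero hD0 hm0)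
    exact (Real.rpow_pos_of_pos (hgpos _ h1) _).trans_le (hqmax ⟨⟨_, rfl⟩, h2⟩)
  have hϖ0 : ϖ ≠ 0 := by
    rintro rfl
    rw [hgn, norm_zero, zero_pow hD0, zero_pow hm0] at hϖ
    exact hq0.ne hϖ
  have hqpos : (0 : ℝ) < q := inv_pos.1 hq0
  have hgϖ : g ((ϖ ^ d)⁻¹) ^ m = (q : ℝ) ^ d := by
    have h : (q : ℝ) = (g ϖ ^ m)⁻¹ := by rw [hϖ, inv_inv]
    rw [h, hgn, hgn, norm_inv, norm_pow]
    simp only [inv_pow, ← pow_mul]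
    congr 2
    ring
  set t : L := (ϖ ^ d)⁻¹ * algebraMap k L m with ht
  have hmL : algebraMap k L m ≠ 0 := (map_ne_zero _).2 hmk
  have ht0 : t ≠ 0 := mul_ne_zero (inv_ne_zero (pow_ne_zero _ hϖ0)) hmL
  have hgt : g t ^ m = (q : ℝ) ^ d * absk p k (m : k) ^ m := by
    rw [ht, hgmul, mul_pow, hgϖ, hgc]
  have hrad : (q : ℝ) ^ ((d : ℝ) / (m : ℝ)) * absk p k (m : k) = g t := by
    rw [ht, hgmul, hgc, div_eq_mul_inv, Real.rpow_mul hqpos.le, Real.rpow_natCast, ← hgϖ,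
      Real.pow_rpow_inv_natCast (hg0 _) hm0]
  have hdual (z : L) : ‖z‖ ≤ ‖t‖ ↔
      ∀ a : L, ‖a‖ ≤ 1 → χ ((m : k)⁻¹ * Algebra.trace k L (a * z)) = 1 := by
    obtain ⟨w, hzw⟩ : ∃ w, z = algebraMap k L m * w := ⟨_, (mul_inv_cancel_left₀ hmL z).symm⟩
    have htr (a : L) : (m : k)⁻¹ * Algebra.trace k L (a * z) = Algebra.trace k L (w * a) := by
      rw [hzw, mul_left_comm, ← Algebra.smul_def, map_smul, smul_eq_mul, inv_mul_cancel_left₀ hmk,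
        mul_comm a]
    have h1 : ‖z‖ ≤ ‖t‖ ↔ g w ^ (m : ℝ) ≤ (q : ℝ) ^ (d : ℝ) := by
      rw [Real.rpow_natCast, Real.rpow_natCast, ← hgϖ, pow_le_pow_iff_left₀ (hg0 _) (hg0 _) hm0, hgle,
        hzw, ht, norm_mul, norm_mul, mul_comm ‖algebraMap k L m‖, mul_le_mul_iff_left₀ (norm_pos_iff.2 hmL)]
    rw [h1, hd]
    simp only [htr, ← hg1]
    refine ⟨fun h a ha => hχtriv _ (h a ha), fun h y hy => ?_⟩
    by_contra! hs
    set s := Algebra.trace k L (w * y) with hs'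
    have hs0 : s ≠ 0 := by
      intro h0
      rw [h0] at hs
      simp [absk] at hs
      linarith
    obtain ⟨x, hx, hx'⟩ := hχrank
    apply hx'
    rw [← h (algebraMap k L (x / s) * y) ?_]
    · rw [mul_left_comm, ← Algebra.smul_def, map_smul, smul_eq_mul, ← hs', div_mul_cancel₀ _ hs0]
    · rw [hgmul, hgc]
      refine mul_le_one₀ ?_ (hg0 _) hy
      have h2 : absk p k (x / s) * absk p k s = absk p k x := by
        rw [← absk_mul, div_mul_cancel₀ _ hs0]
      have h3 := hx.trans (hr s hs)
      rw [← h2] at h3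
      exact le_of_mul_le_mul_right (by rwa [one_mul]) (one_pos.trans hs)
  have hball (s : L) : {z | g z ≤ g s} = Metric.closedBall 0 ‖s‖ := by
    ext z; simp [hgle]
  have hball1 : {z | g z ≤ 1} = Metric.closedBall 0 1 := by
    ext z; simp [hg1]
  rw [hball1] at hvol
  have hν' : ν = _ := eq_smul_restrict_closedBall p vol hvol
    (fun z => χ ((m : k)⁻¹ * Algebra.trace k L z)) (fun x y => by rw [map_add, mul_add, hχadd])
    (fun x => hχnorm _) (continuous_char_trace p k L χ hχcont _) t ht0 hdual ν
    (fun a => by rw [hν]; simp only [hg1])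
  rw [hrad, hball, hν', ← finrank_mul_finrank ℚ_[p] k L, ← hD, ← hm, pow_mul, ← hgn, hgt, mul_inv,
    zpow_neg, zpow_natCast]
end

theorem statement_7
    (p : ℕ) [Fact (Nat.Prime p)]
    (k : Type) [Field k] [Algebra ℚ_[p] k] [FiniteDimensional ℚ_[p] k]
    (K : Type) [Field K] [Algebra k K] [CharZero K]
    (Kn : ℕ → IntermediateField k K)
    (hbot : Kn 1 = ⊥) (hmono : Monotone Kn)
    [hfd : ∀ n, FiniteDimensional k (Kn n)]
    (hunion : ∀ x : K, ∃ n, x ∈ Kn n)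
    (T : ℕ → K →ₗ[k] K)
    (hTmem : ∀ (n : ℕ) (x : K), T n x ∈ Kn n)
    (hTdef : ∀ (n ν : ℕ) (h : n ≤ ν) (x : K) (hx : x ∈ Kn ν),
      T n x = ((finrank k (Kn n) : K) / (finrank k (Kn ν) : K)) *
        (relTrace k K (Kn n) (Kn ν) (hmono h) ⟨x, hx⟩ : K))
    (Knorm : K → ℝ)
    (hKnorm : ∀ (n : ℕ) (x : K) (hx : x ∈ Kn n),
      Knorm x = absk p k (Algebra.norm k (⟨x, hx⟩ : Kn n)) ^ ((finrank k (Kn n) : ℝ)⁻¹))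
    (pairing : K → ProjLim k K Kn T → k)
    (hpair : ∀ (n : ℕ) (a : K) (ha : a ∈ Kn n) (x : ProjLim k K Kn T),
      pairing a x = (finrank k (Kn n) : k)⁻¹ *
        Algebra.trace k (Kn n) (⟨a * x.1 n, mul_mem ha (x.2.1 n)⟩ : Kn n))
    (q : ℕ → ℕ)
    (hq : ∀ n : ℕ, IsGreatest
      {r : ℝ | (∃ x : Kn n, Knorm ↑x ^ (finrank k (Kn n) : ℝ) = r) ∧ r < 1} ((q n : ℝ)⁻¹))
    (χ : k → ℂ)
    (hχadd : ∀ x y : k, χ (x + y) = χ x * χ y)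
    (hχnorm : ∀ x : k, ‖χ x‖ = 1)
    (hχcont : @Continuous _ _ (kTop p k) _ χ)
    (hχtriv : ∀ x : k, absk p k x ≤ 1 → χ x = 1)
    (hχrank : ∃ x : k, absk p k x ≤ (q 1 : ℝ) ∧ χ x ≠ 1)
    (d : ℕ → ℕ)
    (hd : ∀ (n : ℕ) (x : Kn n),
      Knorm ↑x ^ (finrank k (Kn n) : ℝ) ≤ (q n : ℝ) ^ (d n : ℝ) ↔
        ∀ y : Kn n, Knorm ↑y ≤ 1 → absk p k (Algebra.trace k (Kn n) (x * y)) ≤ 1)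
    (vol : ∀ n : ℕ, @MeasureTheory.Measure (Kn n) (KnMeas k K Kn Knorm n))
    (hvolinv : ∀ (n : ℕ) (a : Kn n) (A : Set (Kn n)),
      MeasurableSet[KnMeas k K Kn Knorm n] A → vol n ((fun z => a + z) ⁻¹' A) = vol n A)
    (hvolnorm : ∀ n : ℕ, vol n {z : Kn n | Knorm ↑z ≤ 1} = 1)
    (μ : @MeasureTheory.Measure (ProjLim k K Kn T) (projMeas k K Kn T Knorm))
    (hμprob : MeasureTheory.IsProbabilityMeasure μ)
    (hμradon : ∀ A : Set (ProjLim k K Kn T), MeasurableSet[projMeas k K Kn T Knorm] A →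
      μ A = ⨆ (C : Set (ProjLim k K Kn T))
        (_ : C ⊆ A ∧ @IsCompact _ (projTop k K Kn T Knorm) C), μ C)
    (hμchar : ∀ a : K, ∫ x, χ (pairing a x) ∂μ = if Knorm a ≤ 1 then (1 : ℂ) else 0)
    :
    ∀ n : ℕ, 1 ≤ n → ∀ φ : Kn n → ℂ, MeasureTheory.Integrable φ (vol n) →
      MeasureTheory.Integrable (fun x : ProjLim k K Kn T => φ ⟨x.1 n, x.2.1 n⟩) μ ∧
      ∫ x, φ ⟨x.1 n, x.2.1 n⟩ ∂μ =
        (((((q n : ℝ) ^ (d n : ℕ))⁻¹ *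
            absk p k (finrank k (Kn n) : k) ^ (-(finrank k (Kn n) : ℤ))) : ℝ) : ℂ) *
          ∫ z in {z : Kn n |
              Knorm ↑z ≤ (q n : ℝ) ^ ((d n : ℝ) / (finrank k (Kn n) : ℝ)) *
                absk p k (finrank k (Kn n) : k)}, φ z ∂(vol n) := by
  intro n hn φ hφ
  have hKadd (x y : K) : Knorm (x + y) ≤ max (Knorm x) (Knorm y) := by
    obtain ⟨i, hi⟩ := hunion x
    obtain ⟨j, hj⟩ := hunion y
    have hx := hmono (le_max_left i j) hi
    have hy := hmono (le_max_right i j) hj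
    rw [hKnorm _ x hx, hKnorm _ y hy, hKnorm _ _ (add_mem hx hy)]
    exact absk_norm_rpow_add_le p k (Kn (max i j)) ⟨x, hx⟩ ⟨y, hy⟩
  let : Algebra ℚ_[p] (Kn n) := ((algebraMap k (Kn n)).comp (algebraMap ℚ_[p] k)).toAlgebra
  have : IsScalarTower ℚ_[p] k (Kn n) := IsScalarTower.of_algebraMap_eq fun _ => rfl
  have : FiniteDimensional ℚ_[p] (Kn n) := FiniteDimensional.trans ℚ_[p] k (Kn n)
  have := isUltrametricDist_spectralNorm ℚ_[p] (Kn n)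
  let := spectralNorm.normedField ℚ_[p] (Kn n)
  let := spectralNorm.normedAlgebra ℚ_[p] (Kn n)
  let : MeasurableSpace (Kn n) := KnMeas k K Kn Knorm n
  let : MeasurableSpace (ProjLim k K Kn T) := projMeas k K Kn T Knorm
  have hg (x : Kn n) : Knorm x = absk p k (Algebra.norm k x) ^ ((finrank k (Kn n) : ℝ)⁻¹) :=
    hKnorm n x x.2
  have htop : KnTop k K Kn Knorm n = UniformSpace.toTopologicalSpace :=
    induced_normTopology_eq ((Kn n).val : Kn n →+ K) Knorm hKadd (finrank ℚ_[p] k)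
      finrank_pos.ne' fun z => (hg z).trans (absk_norm_rpow_eq p k (Kn n) z)
  have : BorelSpace (Kn n) := ⟨by rw [← htop]; rfl⟩
  have : (vol n).IsAddLeftInvariant := ⟨fun a => by
    ext A hA
    rw [Measure.map_apply (measurable_const_add a) hA]
    exact hvolinv n a A hA⟩
  let π : ProjLim k K Kn T → Kn n := fun x => ⟨x.1 n, x.2.1 n⟩
  have hπ : Measurable π := by
    let := projTop k K Kn T Knorm
    have : BorelSpace (ProjLim k K Kn T) := ⟨rfl⟩
    refine Continuous.measurable ?_
    rw [continuous_iff_continuousAt]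
    intro x
    rw [ContinuousAt, Metric.tendsto_nhds]
    intro ε hε
    have hU : IsOpen {y : ProjLim k K Kn T | Knorm (y.1 n - x.1 n) < ε ^ finrank ℚ_[p] k} :=
      TopologicalSpace.isOpen_generateFrom_of_mem ⟨x, n, _, by positivity, rfl⟩
    have hy (y : ProjLim k K Kn T) : Knorm (y.1 n - x.1 n) = dist (π y) (π x) ^ finrank ℚ_[p] k := by
      rw [dist_eq_norm, ← absk_norm_rpow_eq p k (Kn n), ← hg]
      rfl
    filter_upwards [hU.mem_nhds (by
      change Knorm _ < _
      rw [hy x, dist_self, zero_pow finrank_pos.ne']; positivity)] with y hy'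
    exact lt_of_pow_lt_pow_left₀ _ hε.le ((hy y).symm.trans_lt hy')
  have hr (x : k) (hx : 1 < absk p k x) : (q 1 : ℝ) ≤ absk p k x := by
    have hK1 : finrank k (Kn 1) = 1 := by rw [hbot]; exact IntermediateField.finrank_bot
    have hx0 : x ≠ 0 := by
      rintro rfl
      simp [absk] at hx
      linarith
    have h1 : absk p k x⁻¹ = (absk p k x)⁻¹ :=
      eq_inv_of_mul_eq_one_left (by rw [← absk_mul, inv_mul_cancel₀ hx0]; simp [absk])
    have h2 := (hq 1).2 ⟨⟨algebraMap k (Kn 1) x⁻¹, rfl⟩, by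
      rw [hKnorm 1 _ (algebraMap k (Kn 1) x⁻¹).2, Subtype.coe_eta, absk_norm_algebraMap_rpow, hK1,
        Nat.cast_one, Real.rpow_one, h1]
      exact inv_lt_one_of_one_lt₀ hx⟩
    rw [hKnorm 1 _ (algebraMap k (Kn 1) x⁻¹).2, Subtype.coe_eta, absk_norm_algebraMap_rpow, hK1,
      Nat.cast_one, Real.rpow_one, h1] at h2
    rcases (q 1).cast_nonneg (α := ℝ) |>.eq_or_lt with h0 | h0
    · rw [← h0]; linarith
    · exact (inv_le_inv₀ (by linarith) h0).1 h2
  have : IsFiniteMeasure (μ.map π) := inferInstance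
  have hν := eq_smul_restrict_of_integral_char_trace p k (Kn n) (vol n) (fun z => Knorm z) hg
    (hvolnorm n) (q n) (d n) (q 1) (hq n) χ hχadd hχnorm hχcont hχtriv hr hχrank (hd n) (μ.map π) ?_
  · have hc : 0 ≤ ((q n : ℝ) ^ d n)⁻¹ *
        absk p k (finrank k (Kn n) : k) ^ (-(finrank k (Kn n) : ℤ)) :=
      mul_nonneg (by positivity) (zpow_nonneg (norm_nonneg _) _)
    have hint : Integrable φ (μ.map π) := by
      rw [hν]
      exact hφ.restrict.smul_measure ENNReal.ofReal_ne_top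
    refine ⟨hint.comp_measurable hπ, ?_⟩
    have h1 := integral_map hπ.aemeasurable hint.aestronglyMeasurable
    refine h1.symm.trans ?_
    rw [hν, integral_smul_measure, ENNReal.toReal_ofReal hc, Complex.real_smul]
  · intro a
    have hcont : Continuous fun z : Kn n =>
        χ ((finrank k (Kn n) : k)⁻¹ * Algebra.trace k (Kn n) (a * z)) :=
      (continuous_char_trace p k (Kn n) χ hχcont _).comp (continuous_const_mul a)
    rw [integral_map hπ.aemeasurable hcont.aestronglyMeasurable, ← hμchar a]
    congr 1
    ext x
    rw [hpair n a a.2 x]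
    rfl
end
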